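/- Let α > 0, m > α, set a = m − α, and let f be the unique density solution to the equation x^m f(x) = (1/Γ(α)) ∫_0^x (x−v)^{α−1} f(v) dv on (0,∞). Then for every s > −a, the Mellin transform M(s) = ∫_0^∞ x^{−s} f(x) dx is finite and equals the limit, as N → ∞, of (Γ(m)/Γ(a))^{s/a} · ∏_{n=0}^{N} [ ((m+n)/(a+n))^{s/a} · Γ(1+(n+s)/a) Γ((m+n)/a) / ( Γ(1+n/a) Γ((m+n+s)/a) ) ]. -/

import Mathlib

open MeasureTheory Real Set Filter

noncomputable section

/-- `f` is a density solution to the integro-differential equation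
`I^α_{0+} f = x^m f` on `(0,∞)`: `f` is measurable, nonnegative on `(0,∞)`,
integrates to `1` on `(0,∞)`, and satisfies
`x^m f(x) = (1/Γ(α)) ∫_0^x (x−v)^{α−1} f(v) dv` for every `x > 0`. -/
def IsDensitySolution (α m : ℝ) (f : ℝ → ℝ) : Prop :=
  Measurable f ∧ (∀ x ∈ Set.Ioi (0:ℝ), 0 ≤ f x) ∧
  (∫ x in Set.Ioi (0:ℝ), f x) = 1 ∧
  ∀ x ∈ Set.Ioi (0:ℝ),
    x ^ m * f x = (1 / Real.Gamma α) * ∫ v in Set.Ioo (0:ℝ) x, (x - v) ^ (α - 1) * f v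

theorem tendsto_of_convexOn_of_tendsto_shift_sub {a : ℝ} (ha : 0 < a) {L : ℝ → ℝ}
    {Ls : ℕ → ℝ → ℝ} (hL : ConvexOn ℝ (Ioi (-a)) L) (hLs : ∀ N, ConvexOn ℝ (Ioi (-a)) (Ls N))
    (h0 : ∀ N, Ls N 0 = L 0)
    (hshift : ∀ s, -a < s →
      Tendsto (fun N => Ls N (s + a) - Ls N s) atTop (nhds (L (s + a) - L s)))
    (hdiff : Tendsto (fun n : ℕ => L (n * a + a + a) - L (n * a + a) - (L (n * a + a) - L (n * a)))
      atTop (nhds 0)) :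
    ∀ s, -a < s → Tendsto (fun N => Ls N s) atTop (nhds (L s)) := by
  have hmul : ∀ n : ℕ, ∀ s, -a < s →
      Tendsto (fun N => Ls N (s + n * a) - Ls N s) atTop (nhds (L (s + n * a) - L s)) := by
    intro n s hs
    induction n with
    | zero => simp
    | succ n ih =>
      have hn : 0 ≤ n * a := by positivity
      convert (hshift (s + n * a) (by linarith)).add ih using 1
      · ext N
        push_cast
        ring_nf
      · push_cast
        ring_nf
  have hgrid : ∀ n : ℕ, Tendsto (fun N => Ls N (n * a)) atTop (nhds (L (n * a))) := by
    intro n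
    have := (hmul n 0 (by linarith)).add_const (L 0)
    simp only [h0, zero_add, sub_add_cancel] at this
    exact this
  have hbase : ∀ r, 0 ≤ r → r ≤ a → Tendsto (fun N => Ls N r) atTop (nhds (L r)) := by
    intro r hr0 hra
    rw [Metric.tendsto_atTop']
    intro ε' hε'
    obtain ⟨ε, hε, rfl⟩ : ∃ ε, 0 < ε ∧ 6 * ε = ε' := ⟨ε' / 6, by positivity, by ring⟩
    obtain ⟨n, hn⟩ := (hdiff.eventually (gt_mem_nhds hε)).exists
    have hg : ∀ k : ℕ, ∀ᶠ N in atTop, |Ls N (k * a) - L (k * a)| < ε := fun k => by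
      simpa only [Real.dist_eq] using Metric.tendsto_nhds.mp (hgrid k) ε hε
    have hm : ∀ᶠ N in atTop,
        |Ls N (r + (n + 1 : ℕ) * a) - Ls N r - (L (r + (n + 1 : ℕ) * a) - L r)| < ε := by
      simpa only [Real.dist_eq] using Metric.tendsto_nhds.mp (hmul (n + 1) r (by linarith)) ε hε
    have key : ∀ᶠ N in atTop, dist (Ls N r) (L r) < 6 * ε := by
      filter_upwards [hg n, hg (n + 1), hg (n + 2), hm] with N h1 h2 h3 h4
      have e2 : ((n + 1 : ℕ) : ℝ) * a = n * a + a := by push_cast; ring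
      have e3 : ((n + 2 : ℕ) : ℝ) * a = n * a + a + a := by push_cast; ring
      rw [e2] at h2 h4
      rw [e3] at h3
      obtain ⟨θ, hθ0, hθ1, rfl⟩ : ∃ θ, 0 ≤ θ ∧ θ ≤ 1 ∧ θ * a = r :=
        ⟨r / a, by positivity, (div_le_one ha).mpr hra, by field_simp⟩
      have hna : 0 ≤ n * a := by positivity
      have hup : ∀ g : ℝ → ℝ, ConvexOn ℝ (Ioi (-a)) g →
          g (θ * a + (n * a + a)) ≤ (1 - θ) * g (n * a + a) + θ * g (n * a + a + a) := by
        intro g hg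
        have hx : n * a + a ∈ Ioi (-a) := mem_Ioi.mpr (by linarith)
        have hy : n * a + a + a ∈ Ioi (-a) := mem_Ioi.mpr (by linarith)
        have := hg.2 hx hy (sub_nonneg.mpr hθ1) hθ0 (by ring)
        simp only [smul_eq_mul] at this
        have e : (1 - θ) * (n * a + a) + θ * (n * a + a + a) = θ * a + (n * a + a) := by ring
        rwa [e] at this
      have hlow : ∀ g : ℝ → ℝ, ConvexOn ℝ (Ioi (-a)) g →
          (1 + θ) * g (n * a + a) ≤ g (θ * a + (n * a + a)) + θ * g (n * a) := by
        intro g hg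
        have hp : 0 < 1 + θ := by linarith
        have hx : θ * a + (n * a + a) ∈ Ioi (-a) := mem_Ioi.mpr (by linarith)
        have hy : n * a ∈ Ioi (-a) := mem_Ioi.mpr (by linarith)
        have hw1 : 0 ≤ 1 / (1 + θ) := by positivity
        have hw2 : 0 ≤ θ / (1 + θ) := by positivity
        have := hg.2 hx hy hw1 hw2 (by field_simp)
        simp only [smul_eq_mul] at this
        have e : 1 / (1 + θ) * (θ * a + (n * a + a)) + θ / (1 + θ) * (n * a) = n * a + a := by
          field_simp
          ring
        rw [e] at this
        have := mul_le_mul_of_nonneg_left this hp.le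
        refine this.trans (le_of_eq ?_)
        field_simp
      have u1 := hup L hL
      have u2 := hup _ (hLs N)
      have l1 := hlow L hL
      have l2 := hlow _ (hLs N)
      rw [Real.dist_eq, abs_lt]
      rw [abs_lt] at h1 h2 h3 h4
      have hθ' : 0 ≤ 1 - θ := by linarith
      have p1 := mul_le_mul_of_nonneg_left h1.1.le hθ0
      have p2 := mul_le_mul_of_nonneg_left h1.2.le hθ0
      have p3 := mul_le_mul_of_nonneg_left h2.1.le hθ0
      have p4 := mul_le_mul_of_nonneg_left h2.2.le hθ0
      have p5 := mul_le_mul_of_nonneg_left h3.1.le hθ0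
      have p6 := mul_le_mul_of_nonneg_left h3.2.le hθ0
      have p7 := mul_le_mul_of_nonneg_left hn.le hθ0
      have p8 := mul_le_mul_of_nonneg_right hθ1 hε.le
      constructor <;> nlinarith
    obtain ⟨N, hN⟩ := eventually_atTop.mp key
    exact ⟨N, fun k hk => hN k hk.le⟩
  have hnonneg : ∀ n : ℕ, ∀ s, 0 ≤ s → s ≤ n * a →
      Tendsto (fun N => Ls N s) atTop (nhds (L s)) := by
    intro n s hs hsn
    have hk := Nat.floor_le (div_nonneg hs ha.le)
    have hk' := Nat.lt_floor_add_one (s / a)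
    set k := ⌊s / a⌋₊
    rw [le_div_iff₀ ha] at hk
    rw [div_lt_iff₀ ha] at hk'
    have := (hmul k (s - k * a) (by linarith)).add (hbase (s - k * a) (by linarith) (by linarith))
    simpa using this
  intro s hs
  obtain ⟨n, hn⟩ := exists_nat_ge ((s + a) / a)
  rw [div_le_iff₀ ha] at hn
  simpa using (hnonneg n (s + a) (by linarith) hn).sub (hshift s hs)

theorem convexOn_log_add_sub_log {c : ℝ} (hc : 0 ≤ c) :
    ConvexOn ℝ (Ioi 0) fun x => log (x + c) - log x := by
  have hd : ∀ x ∈ Ioi (0 : ℝ), HasDerivAt (fun x => log (x + c) - log x) (1 / (x + c) - x⁻¹) x := by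
    intro x hx
    have hx : 0 < x := hx
    exact (((hasDerivAt_id x).add_const c).log (by positivity)).sub (hasDerivAt_log hx.ne')
  refine MonotoneOn.convexOn_of_deriv (convex_Ioi 0)
    (fun x hx => (hd x hx).continuousAt.continuousWithinAt) ?_ ?_
  · rw [interior_Ioi]
    exact fun x hx => (hd x hx).differentiableAt.differentiableWithinAt
  · rw [interior_Ioi]
    intro x hx y hy hxy
    rw [(hd x hx).deriv, (hd y hy).deriv]
    have hx : 0 < x := hx
    have hy : 0 < y := hy
    have h : ∀ z, 0 < z → 1 / (z + c) - z⁻¹ = -(c / (z * (z + c))) := by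
      intro z hz
      field_simp
      ring
    rw [h x hx, h y hy]
    gcongr

theorem convexOn_log_Gamma_sub_log_Gamma_add {c : ℝ} (hc : 0 ≤ c) :
    ConvexOn ℝ (Ioi 0) fun x => log (Gamma x) - log (Gamma (x + c)) := by
  refine ⟨convex_Ioi 0, fun x hx y hy p q hp hq hpq => ?_⟩
  have hlim : ∀ x ∈ Ioi (0 : ℝ), Tendsto
      (fun n => BohrMollerup.logGammaSeq x n - BohrMollerup.logGammaSeq (x + c) n) atTop
      (nhds (log (Gamma x) - log (Gamma (x + c)))) := fun x hx =>
    (BohrMollerup.tendsto_log_gamma hx).sub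
      (BohrMollerup.tendsto_log_gamma (add_pos_of_pos_of_nonneg hx hc))
  refine le_of_tendsto_of_tendsto' (hlim _ (convex_Ioi 0 hx hy hp hq hpq))
    (((hlim x hx).const_mul p).add ((hlim y hy).const_mul q)) fun n => ?_
  have hform : ∀ z, BohrMollerup.logGammaSeq z n - BohrMollerup.logGammaSeq (z + c) n =
      -c * log n + ∑ j ∈ Finset.range (n + 1), (log (z + j + c) - log (z + j)) := by
    intro z
    simp only [BohrMollerup.logGammaSeq, Finset.sum_sub_distrib, add_right_comm z c]
    ring
  simp only [hform, mul_add, Finset.mul_sum, smul_eq_mul]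
  rw [add_add_add_comm, ← add_mul, hpq, one_mul, ← Finset.sum_add_distrib]
  gcongr with j
  have hxj : x + j ∈ Ioi (0 : ℝ) :=
    mem_Ioi.mpr (add_pos_of_pos_of_nonneg hx j.cast_nonneg)
  have hyj : y + j ∈ Ioi (0 : ℝ) :=
    mem_Ioi.mpr (add_pos_of_pos_of_nonneg hy j.cast_nonneg)
  have h := (convexOn_log_add_sub_log hc).2 hxj hyj hp hq hpq
  simp only [smul_eq_mul] at h
  have e : p * (x + j) + q * (y + j) = p * x + q * y + j := by
    linear_combination (j : ℝ) * hpq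
  rwa [e] at h

theorem log_Gamma_add_sub_log_Gamma_mono {c x y : ℝ} (hc : 0 ≤ c) (hx : 0 < x) (hxy : x ≤ y) :
    log (Gamma (x + c)) - log (Gamma x) ≤ log (Gamma (y + c)) - log (Gamma y) := by
  rcases hc.eq_or_lt with rfl | hc
  · simp
  obtain ⟨h, hh, rfl⟩ : ∃ h, 0 ≤ h ∧ x + h = y := ⟨y - x, by linarith, by ring⟩
  have hp : 0 < c + h := by positivity
  have hx' : x + h + c ∈ Ioi (0 : ℝ) := mem_Ioi.mpr (by positivity)
  have hwc : 0 ≤ c / (c + h) := by positivity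
  have hwh : 0 ≤ h / (c + h) := by positivity
  have h1 := convexOn_log_Gamma.2 hx hx' hwh hwc (by field_simp; ring)
  have h2 := convexOn_log_Gamma.2 hx hx' hwc hwh (by field_simp)
  simp only [smul_eq_mul, Function.comp_apply] at h1 h2
  have e1 : h / (c + h) * x + c / (c + h) * (x + h + c) = x + c := by field_simp; ring
  have e2 : c / (c + h) * x + h / (c + h) * (x + h + c) = x + h := by field_simp; ring
  have e3 : h / (c + h) = 1 - c / (c + h) := by field_simp; ring
  rw [e1] at h1
  rw [e2] at h2
  rw [e3] at h1 h2
  linarith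

theorem tendsto_log_Gamma_add_sub_log_Gamma_sub {c b : ℝ} (hc : 0 ≤ c) (hb : 0 ≤ b) :
    Tendsto (fun y => log (Gamma (y + b + c)) - log (Gamma (y + b)) -
      (log (Gamma (y + c)) - log (Gamma y))) atTop (nhds 0) := by
  obtain ⟨K, hK⟩ := exists_nat_ge b
  have hstep : ∀ K : ℕ, ∀ y : ℝ, 0 < y → log (Gamma (y + K + c)) - log (Gamma (y + K)) -
      (log (Gamma (y + c)) - log (Gamma y)) =
      ∑ j ∈ Finset.range K, log (1 + c / (y + j)) := by
    intro K y hy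
    induction K with
    | zero => simp
    | succ K ih =>
      have h1 : 0 < y + K := by positivity
      have h2 : 0 < y + K + c := by positivity
      rw [Finset.sum_range_succ, ← ih]
      push_cast
      rw [← add_assoc, add_right_comm _ 1 c, Gamma_add_one h1.ne', Gamma_add_one h2.ne',
        log_mul h1.ne' (Gamma_pos_of_pos h1).ne', log_mul h2.ne' (Gamma_pos_of_pos h2).ne',
        show 1 + c / (y + K) = (y + K + c) / (y + K) by field_simp, log_div h2.ne' h1.ne']
      ring
  have hsum : Tendsto (fun y : ℝ => ∑ j ∈ Finset.range K, log (1 + c / (y + j))) atTop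
      (nhds 0) := by
    rw [← Finset.sum_const_zero (s := Finset.range K) (M := ℝ)]
    refine tendsto_finsetSum _ fun j _ => ?_
    have h : Tendsto (fun y : ℝ => 1 + c / (y + j)) atTop (nhds (1 + 0)) :=
      tendsto_const_nhds.add ((tendsto_atTop_add_const_right _ _ tendsto_id).const_div_atTop c)
    rw [add_zero] at h
    simpa using h.log one_ne_zero
  refine tendsto_of_tendsto_of_tendsto_of_le_of_le' tendsto_const_nhds hsum ?_ ?_
  · filter_upwards [eventually_gt_atTop 0] with y hy
    rw [sub_nonneg]
    exact log_Gamma_add_sub_log_Gamma_mono hc hy (by linarith)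
  · filter_upwards [eventually_gt_atTop 0] with y hy
    rw [← hstep K y hy]
    exact sub_le_sub_right
      (log_Gamma_add_sub_log_Gamma_mono hc (by positivity) (by linarith)) _

theorem tendsto_sum_log_ratio {a m s : ℝ} (ha : 0 < a) (hm : 0 < m) (has : 0 < a + s)
    (hms : 0 < m + s) :
    Tendsto (fun N : ℕ => ∑ n ∈ Finset.range (N + 1),
        (log (m + n) - log (a + n) + (log (a + s + n) - log (m + s + n)))) atTop
      (nhds (log (Gamma a) - log (Gamma m) + (log (Gamma (m + s)) - log (Gamma (a + s))))) := by
  have := ((BohrMollerup.tendsto_log_gamma ha).sub (BohrMollerup.tendsto_log_gamma hm)).add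
    ((BohrMollerup.tendsto_log_gamma hms).sub (BohrMollerup.tendsto_log_gamma has))
  refine this.congr fun N => ?_
  simp only [BohrMollerup.logGammaSeq, Finset.sum_sub_distrib, Finset.sum_add_distrib]
  ring

open scoped ENNReal in
theorem lintegral_mul_lintegral_Ioo_swap {w g k : ℝ → ℝ≥0∞} (hw : Measurable w)
    (hg : Measurable g) (hk : Measurable k) :
    ∫⁻ x in Ioi (0 : ℝ), w x * ∫⁻ v in Ioo 0 x, k (x - v) * g v =
      ∫⁻ v in Ioi (0 : ℝ), g v * ∫⁻ x in Ioi v, w x * k (x - v) := by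
  have hmeas : Measurable (Function.uncurry fun x v : ℝ =>
      {p : ℝ × ℝ | p.2 < p.1}.indicator (fun p => w p.1 * (k (p.1 - p.2) * g p.2)) (x, v)) := by
    refine Measurable.indicator ?_ (measurableSet_lt measurable_snd measurable_fst)
    fun_prop
  calc
    _ = ∫⁻ x in Ioi (0 : ℝ), ∫⁻ v in Ioi (0 : ℝ),
        {p : ℝ × ℝ | p.2 < p.1}.indicator (fun p => w p.1 * (k (p.1 - p.2) * g p.2)) (x, v) := by
      refine lintegral_congr fun x => ?_
      rw [← lintegral_const_mul _ (by fun_prop), ← Ioi_inter_Iio, inter_comm,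
        ← Measure.restrict_restrict measurableSet_Iio, ← lintegral_indicator measurableSet_Iio]
      rfl
    _ = ∫⁻ v in Ioi (0 : ℝ), ∫⁻ x in Ioi (0 : ℝ),
        {p : ℝ × ℝ | p.2 < p.1}.indicator (fun p => w p.1 * (k (p.1 - p.2) * g p.2)) (x, v) :=
      lintegral_lintegral_swap hmeas.aemeasurable
    _ = _ := by
      refine setLIntegral_congr_fun measurableSet_Ioi fun v hv => ?_
      have hv : 0 < v := hv
      have hsub : ∫⁻ x in Ioi v, g v * (w x * k (x - v)) =
          ∫⁻ x in Ioi 0, (Ioi v).indicator (fun x => g v * (w x * k (x - v))) x := by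
        rw [lintegral_indicator measurableSet_Ioi, Measure.restrict_restrict measurableSet_Ioi,
          inter_eq_left.mpr (Ioi_subset_Ioi hv.le)]
      rw [← lintegral_const_mul _ (by fun_prop), hsub]
      refine lintegral_congr fun x => ?_
      simp only [indicator, mem_ofPred_eq, mem_Ioi]
      split_ifs
      · ring
      · rfl

theorem lintegral_Ioo_rpow_mul_one_sub_rpow {p q : ℝ} (hp : 0 < p) (hq : 0 < q) :
    ∫⁻ x in Ioo (0 : ℝ) 1, ENNReal.ofReal (x ^ (p - 1) * (1 - x) ^ (q - 1)) =
      ENNReal.ofReal (ProbabilityTheory.beta p q) := by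
  have hb := ProbabilityTheory.beta_pos hp hq
  have h := ProbabilityTheory.lintegral_betaPDF_eq_one hp hq
  rw [ProbabilityTheory.lintegral_betaPDF] at h
  simp_rw [mul_assoc, ENNReal.ofReal_mul (one_div_pos.mpr hb).le] at h
  rw [lintegral_const_mul _ (by fun_prop), mul_comm, one_div, ENNReal.ofReal_inv_of_pos hb,
    ← div_eq_mul_inv, ENNReal.div_eq_one_iff (by simpa using hb) ENNReal.ofReal_ne_top] at h
  exact h

theorem lintegral_Ioi_rpow_mul_sub_rpow {t α v : ℝ} (hα : 0 < α) (ht : α < t) (hv : 0 < v) :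
    ∫⁻ x in Ioi v, ENNReal.ofReal (x ^ (-t)) * ENNReal.ofReal ((x - v) ^ (α - 1)) =
      ENNReal.ofReal (v ^ (α - t)) * ENNReal.ofReal (ProbabilityTheory.beta (t - α) α) := by
  have himage : (fun y => v / y) '' Ioo 0 1 = Ioi v := by
    ext x
    constructor
    · rintro ⟨y, ⟨hy0, hy1⟩, rfl⟩
      exact (lt_div_iff₀ hy0).mpr (mul_lt_of_lt_one_right hv hy1)
    · intro hx
      have hx : v < x := hx
      have hx0 : 0 < x := hv.trans hx
      exact ⟨v / x, ⟨by positivity, (div_lt_one hx0).mpr hx⟩, by field_simp⟩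
  rw [← himage, lintegral_image_eq_lintegral_abs_deriv_mul measurableSet_Ioo
    (f' := fun y => -v / y ^ 2), ← lintegral_Ioo_rpow_mul_one_sub_rpow (sub_pos.mpr ht) hα,
    ← lintegral_const_mul _ (by fun_prop)]
  · refine setLIntegral_congr_fun measurableSet_Ioo fun y hy => ?_
    obtain ⟨hy0, hy1⟩ := hy
    have h1 : 0 < 1 - y := by linarith
    have hvy : v / y - v = v * (1 - y) / y := by field_simp
    rw [← ENNReal.ofReal_mul (by positivity), ← ENNReal.ofReal_mul (by positivity),
      ← ENNReal.ofReal_mul (by positivity), hvy, abs_div, abs_neg, abs_of_pos hv,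
      abs_of_pos (by positivity : 0 < y ^ 2)]
    congr 1
    rw [div_rpow hv.le hy0.le, div_rpow (by positivity) hy0.le, mul_rpow hv.le h1.le,
      sub_sub t, rpow_sub hy0 t, rpow_add hy0, rpow_sub hy0 α, rpow_one, rpow_neg hy0.le,
      rpow_neg hv.le, rpow_sub hv, rpow_sub hv, rpow_one]
    have := rpow_pos_of_pos hv t
    have := rpow_pos_of_pos hy0 t
    have := rpow_pos_of_pos hy0 α
    field_simp
  · intro y hy
    have hy0 : y ≠ 0 := hy.1.ne'
    have h : HasDerivAt (fun y => v / y) ((0 * y - v * 1) / y ^ 2) y :=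
      (hasDerivAt_const y v).div (hasDerivAt_id' y) hy0
    rw [zero_mul, mul_one, zero_sub] at h
    exact h.hasDerivWithinAt
  · intro y hy z hz h
    have hy0 : y ≠ 0 := hy.1.ne'
    have hz0 : z ≠ 0 := hz.1.ne'
    have hv0 := hv.ne'
    field_simp at h
    exact h.symm

theorem lintegral_Ioi_exp_neg_mul_sub_rpow {α v : ℝ} (hα : 0 < α) :
    ∫⁻ x in Ioi v, ENNReal.ofReal (exp (-x)) * ENNReal.ofReal ((x - v) ^ (α - 1)) =
      ENNReal.ofReal (exp (-v) * Gamma α) := by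
  have himage : (fun y => y + v) '' Ioi 0 = Ioi v := by simp
  rw [← himage, lintegral_image_eq_lintegral_abs_deriv_mul measurableSet_Ioi
    (f' := fun _ => 1) (fun x _ => ((hasDerivAt_id' x).add_const v).hasDerivWithinAt)
    (add_left_injective v).injOn, ENNReal.ofReal_mul (exp_pos _).le, Gamma_eq_integral hα,
    ofReal_integral_eq_lintegral_ofReal (GammaIntegral_convergent hα),
    ← lintegral_const_mul _ (by fun_prop)]
  · refine lintegral_congr fun x => ?_
    rw [ENNReal.ofReal_mul (exp_pos _).le, ← mul_assoc, ← mul_assoc,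
      ← ENNReal.ofReal_mul (exp_pos _).le, ← exp_add, ← ENNReal.ofReal_mul (by positivity)]
    simp [add_comm]
  · filter_upwards [self_mem_ae_restrict measurableSet_Ioi] with x hx
    have hx : 0 < x := hx
    positivity

/-- The moment `∫_0^∞ x^{-s} f(x) dx`, as an extended nonnegative real. -/
def negMoment (f : ℝ → ℝ) (s : ℝ) : ENNReal :=
  ∫⁻ x in Ioi (0 : ℝ), ENNReal.ofReal (x ^ (-s) * f x)

theorem negMoment_mul_add_le {f : ℝ → ℝ} (hf : Measurable f) (hf0 : ∀ x ∈ Ioi (0 : ℝ), 0 ≤ f x)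
    {p q : ℝ} (hp : 0 ≤ p) (hq : 0 ≤ q) (hpq : p + q = 1) (s t : ℝ) :
    negMoment f (p * s + q * t) ≤ negMoment f s ^ p * negMoment f t ^ q := by
  refine le_trans (le_of_eq ?_) (ENNReal.lintegral_mul_norm_pow_le
    (Measurable.aemeasurable (by fun_prop)) (Measurable.aemeasurable (by fun_prop)) hp hq hpq)
  refine setLIntegral_congr_fun measurableSet_Ioi fun x hx => ?_
  have h0 := hf0 x hx
  have hx : 0 < x := hx
  rw [ENNReal.ofReal_rpow_of_nonneg (by positivity) hp,
    ENNReal.ofReal_rpow_of_nonneg (by positivity) hq, ← ENNReal.ofReal_mul (by positivity)]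
  congr 1
  rw [mul_rpow (by positivity) h0, mul_rpow (by positivity) h0, ← rpow_mul hx.le, ← rpow_mul hx.le,
    mul_mul_mul_comm, ← rpow_add hx, ← rpow_add_of_nonneg h0 hp hq, hpq, rpow_one]
  ring_nf

namespace IsDensitySolution

variable {α m : ℝ} {f : ℝ → ℝ}

theorem integrableOn (hf : IsDensitySolution α m f) : IntegrableOn f (Ioi 0) := by
  by_contra h
  exact zero_ne_one ((integral_undef h).symm.trans hf.2.2.1)

theorem negMoment_zero (hf : IsDensitySolution α m f) : negMoment f 0 = 1 := by
  have h := ofReal_integral_eq_lintegral_ofReal hf.integrableOn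
    (ae_restrict_of_forall_mem measurableSet_Ioi hf.2.1)
  rw [hf.2.2.1, ENNReal.ofReal_one] at h
  simp [negMoment, h]

theorem ae_lintegral_Ioo_lt_top (hα : 0 < α) (hf : IsDensitySolution α m f) :
    ∀ᵐ x ∂volume.restrict (Ioi 0),
      ∫⁻ v in Ioo 0 x, ENNReal.ofReal ((x - v) ^ (α - 1)) * ENNReal.ofReal (f v) < ⊤ := by
  have hfm : Measurable f := hf.1
  have hswap := lintegral_mul_lintegral_Ioo_swap (w := fun x => ENNReal.ofReal (exp (-x)))
    (g := fun x => ENNReal.ofReal (f x)) (k := fun x => ENNReal.ofReal (x ^ (α - 1)))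
    (by fun_prop) (by fun_prop) (by fun_prop)
  have hfin : ∫⁻ x in Ioi (0 : ℝ), ENNReal.ofReal (exp (-x)) *
      ∫⁻ v in Ioo 0 x, ENNReal.ofReal ((x - v) ^ (α - 1)) * ENNReal.ofReal (f v) < ⊤ := by
    rw [hswap]
    calc
      _ ≤ ∫⁻ v in Ioi (0 : ℝ), ENNReal.ofReal (f v) * ENNReal.ofReal (Gamma α) := by
        refine setLIntegral_mono (by fun_prop) fun v hv => ?_
        rw [lintegral_Ioi_exp_neg_mul_sub_rpow hα]
        gcongr
        have := Gamma_pos_of_pos hα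
        exact mul_le_of_le_one_left this.le (exp_le_one_iff.mpr (neg_nonpos.mpr (le_of_lt hv)))
      _ = negMoment f 0 * ENNReal.ofReal (Gamma α) := by
        rw [lintegral_mul_const _ (by fun_prop)]
        simp [negMoment]
      _ < ⊤ := by
        rw [hf.negMoment_zero]
        exact ENNReal.mul_lt_top ENNReal.one_lt_top ENNReal.ofReal_lt_top
  have hmeas : Measurable fun x : ℝ =>
      ∫⁻ v in Ioo 0 x, ENNReal.ofReal ((x - v) ^ (α - 1)) * ENNReal.ofReal (f v) := by
    have h : Measurable (Function.uncurry fun x v : ℝ => {p : ℝ × ℝ | 0 < p.2 ∧ p.2 < p.1}.indicator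
        (fun p => ENNReal.ofReal ((p.1 - p.2) ^ (α - 1)) * ENNReal.ofReal (f p.2)) (x, v)) := by
      refine Measurable.indicator (by fun_prop) ?_
      exact (measurableSet_lt measurable_const measurable_snd).inter
        (measurableSet_lt measurable_snd measurable_fst)
    convert h.lintegral_prod_right (ν := volume) using 2 with x
    rw [← lintegral_indicator measurableSet_Ioo]
    rfl
  filter_upwards [ae_lt_top (by fun_prop) hfin.ne] with x hx
  have h0 : ENNReal.ofReal (exp (-x)) ≠ 0 := by simpa using exp_pos _
  exact (ENNReal.lt_top_of_mul_ne_top_right hx.ne h0)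

theorem ae_ofReal_rpow_mul_eq (hα : 0 < α) (hf : IsDensitySolution α m f) :
    ∀ᵐ x ∂volume.restrict (Ioi 0), ENNReal.ofReal (x ^ m * f x) = ENNReal.ofReal (1 / Gamma α) *
      ∫⁻ v in Ioo 0 x, ENNReal.ofReal ((x - v) ^ (α - 1)) * ENNReal.ofReal (f v) := by
  have hfm : Measurable f := hf.1
  filter_upwards [hf.ae_lintegral_Ioo_lt_top hα, self_mem_ae_restrict measurableSet_Ioi]
    with x hfin hx
  have hΓ := Gamma_pos_of_pos hα
  have hprod : ∫⁻ v in Ioo 0 x, ENNReal.ofReal ((x - v) ^ (α - 1)) * ENNReal.ofReal (f v) =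
      ∫⁻ v in Ioo 0 x, ENNReal.ofReal ((x - v) ^ (α - 1) * f v) :=
    setLIntegral_congr_fun measurableSet_Ioo fun v hv =>
      (ENNReal.ofReal_mul (rpow_nonneg (sub_nonneg.mpr hv.2.le) _)).symm
  rw [hf.2.2.2 x hx, ENNReal.ofReal_mul (by positivity), hprod,
    integral_eq_lintegral_of_nonneg_ae, ENNReal.ofReal_toReal (hprod ▸ hfin.ne)]
  · exact ae_restrict_of_forall_mem measurableSet_Ioo fun v hv =>
      mul_nonneg (rpow_nonneg (sub_nonneg.mpr hv.2.le) _) (hf.2.1 v hv.1)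
  · exact Measurable.aestronglyMeasurable (by fun_prop)

theorem negMoment_eq_mul_negMoment_add (hα : 0 < α) (hf : IsDensitySolution α m f) {s : ℝ}
    (hs : -(m - α) < s) :
    negMoment f s =
      ENNReal.ofReal (Gamma (m - α + s) / Gamma (m + s)) * negMoment f (s + (m - α)) := by
  have hfm : Measurable f := hf.1
  have hΓ := Gamma_pos_of_pos hα
  have hΓ1 : 0 < Gamma (m - α + s) := Gamma_pos_of_pos (by linarith)
  have hΓ2 : 0 < Gamma (m + s) := Gamma_pos_of_pos (by linarith)
  calc
    _ = ∫⁻ x in Ioi (0 : ℝ), ENNReal.ofReal (1 / Gamma α) * (ENNReal.ofReal (x ^ (-(s + m))) *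
        ∫⁻ v in Ioo 0 x, ENNReal.ofReal ((x - v) ^ (α - 1)) * ENNReal.ofReal (f v)) := by
      refine lintegral_congr_ae ?_
      filter_upwards [hf.ae_ofReal_rpow_mul_eq hα, self_mem_ae_restrict measurableSet_Ioi]
        with x h hx
      have hx : 0 < x := hx
      rw [mul_left_comm, ← h, ← ENNReal.ofReal_mul (by positivity), ← mul_assoc, ← rpow_add hx]
      ring_nf
    _ = ENNReal.ofReal (1 / Gamma α) * ∫⁻ v in Ioi (0 : ℝ), ENNReal.ofReal (f v) *
        ∫⁻ x in Ioi v, ENNReal.ofReal (x ^ (-(s + m))) * ENNReal.ofReal ((x - v) ^ (α - 1)) := by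
      rw [lintegral_const_mul' _ _ ENNReal.ofReal_ne_top]
      congr 1
      exact lintegral_mul_lintegral_Ioo_swap (w := fun x => ENNReal.ofReal (x ^ (-(s + m))))
        (g := fun x => ENNReal.ofReal (f x)) (k := fun x => ENNReal.ofReal (x ^ (α - 1)))
        (by fun_prop) (by fun_prop) (by fun_prop)
    _ = ENNReal.ofReal (1 / Gamma α) * (ENNReal.ofReal (ProbabilityTheory.beta (s + m - α) α) *
        negMoment f (s + (m - α))) := by
      congr 1
      rw [negMoment, ← lintegral_const_mul' _ _ ENNReal.ofReal_ne_top]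
      refine setLIntegral_congr_fun measurableSet_Ioi fun v hv => ?_
      have hv : 0 < v := hv
      rw [lintegral_Ioi_rpow_mul_sub_rpow hα (by linarith) hv, ENNReal.ofReal_mul (by positivity),
        show α - (s + m) = -(s + (m - α)) by ring]
      ring
    _ = _ := by
      rw [← mul_assoc, ← ENNReal.ofReal_mul (by positivity), ProbabilityTheory.beta,
        show s + m - α + α = m + s by ring, show s + m - α = m - α + s by ring]
      congr 2
      field_simp

theorem negMoment_lt_top (hα : 0 < α) (hm : α < m) (hf : IsDensitySolution α m f) {s : ℝ}
    (hs : -(m - α) < s) : negMoment f s < ⊤ := by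
  have ha : 0 < m - α := sub_pos.mpr hm
  have hstep : ∀ s, -(m - α) < s → negMoment f s < ⊤ → negMoment f (s + (m - α)) < ⊤ := by
    intro s hs h
    rw [hf.negMoment_eq_mul_negMoment_add hα hs] at h
    have hΓ1 : 0 < Gamma (m - α + s) := Gamma_pos_of_pos (by linarith)
    have hΓ2 : 0 < Gamma (m + s) := Gamma_pos_of_pos (by linarith)
    refine ENNReal.lt_top_of_mul_ne_top_right h.ne ?_
    simpa using div_pos hΓ1 hΓ2
  have hgrid : ∀ n : ℕ, negMoment f (n * (m - α)) < ⊤ := by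
    intro n
    induction n with
    | zero => simp [hf.negMoment_zero]
    | succ n ih =>
      have hn : 0 ≤ n * (m - α) := by positivity
      have := hstep _ (by linarith) ih
      push_cast
      rwa [add_mul, one_mul]
  have hnonneg : ∀ s, 0 ≤ s → negMoment f s < ⊤ := by
    intro s hs
    obtain ⟨n, hn⟩ := exists_nat_ge (s / (m - α))
    rw [div_le_iff₀ ha] at hn
    rcases hs.eq_or_lt with rfl | hs
    · simp [hf.negMoment_zero]
    have hna : 0 < n * (m - α) := hs.trans_le hn
    have h := negMoment_mul_add_le hf.1 hf.2.1 (p := 1 - s / (n * (m - α)))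
      (q := s / (n * (m - α))) (sub_nonneg.mpr ((div_le_one hna).mpr hn)) (by positivity)
      (by ring) 0 (n * (m - α))
    rw [mul_zero, zero_add, div_mul_cancel₀ _ hna.ne', hf.negMoment_zero, ENNReal.one_rpow,
      one_mul] at h
    exact h.trans_lt (ENNReal.rpow_lt_top_of_nonneg (by positivity) (hgrid n).ne)
  rw [hf.negMoment_eq_mul_negMoment_add hα hs]
  exact ENNReal.mul_lt_top ENNReal.ofReal_lt_top (hnonneg _ (by linarith))

theorem negMoment_ne_zero (hf : IsDensitySolution α m f) (s : ℝ) : negMoment f s ≠ 0 := by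
  intro h
  have hfm : Measurable f := hf.1
  have h1 := hf.negMoment_zero
  rw [negMoment, lintegral_eq_zero_iff (by fun_prop)] at h
  refine one_ne_zero (h1.symm.trans ?_)
  rw [negMoment, lintegral_eq_zero_iff (by fun_prop)]
  filter_upwards [h, self_mem_ae_restrict measurableSet_Ioi] with x h hx
  have hx : 0 < x := hx
  simp only [Pi.zero_apply, ENNReal.ofReal_eq_zero, neg_zero, rpow_zero, one_mul] at h ⊢
  exact nonpos_of_mul_nonpos_right h (rpow_pos_of_pos hx _)

theorem toReal_negMoment_pos (hα : 0 < α) (hm : α < m) (hf : IsDensitySolution α m f) {s : ℝ}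
    (hs : -(m - α) < s) : 0 < (negMoment f s).toReal :=
  ENNReal.toReal_pos (hf.negMoment_ne_zero s) (hf.negMoment_lt_top hα hm hs).ne

theorem convexOn_log_negMoment (hα : 0 < α) (hm : α < m) (hf : IsDensitySolution α m f) :
    ConvexOn ℝ (Ioi (-(m - α))) fun s => log (negMoment f s).toReal := by
  refine ⟨convex_Ioi _, fun s hs t ht p q hp hq hpq => ?_⟩
  have hs' := hf.toReal_negMoment_pos hα hm hs
  have ht' := hf.toReal_negMoment_pos hα hm ht
  have hst := hf.toReal_negMoment_pos hα hm (convex_Ioi _ hs ht hp hq hpq)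
  simp only [smul_eq_mul] at hst ⊢
  rw [← log_rpow hs', ← log_rpow ht', ← log_mul (by positivity) (by positivity),
    ENNReal.toReal_rpow, ENNReal.toReal_rpow, ← ENNReal.toReal_mul]
  refine log_le_log hst (ENNReal.toReal_mono ?_ (negMoment_mul_add_le hf.1 hf.2.1 hp hq hpq s t))
  exact ENNReal.mul_ne_top
    (ENNReal.rpow_ne_top_of_nonneg hp (hf.negMoment_lt_top hα hm hs).ne)
    (ENNReal.rpow_ne_top_of_nonneg hq (hf.negMoment_lt_top hα hm ht).ne)

theorem log_negMoment_add_sub (hα : 0 < α) (hm : α < m) (hf : IsDensitySolution α m f) {s : ℝ}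
    (hs : -(m - α) < s) :
    log (negMoment f (s + (m - α))).toReal - log (negMoment f s).toReal =
      log (Gamma (m + s)) - log (Gamma (m - α + s)) := by
  have hΓ1 : 0 < Gamma (m - α + s) := Gamma_pos_of_pos (by linarith)
  have hΓ2 : 0 < Gamma (m + s) := Gamma_pos_of_pos (by linarith)
  have h := hf.toReal_negMoment_pos hα hm (s := s + (m - α)) (by linarith)
  rw [hf.negMoment_eq_mul_negMoment_add hα hs, ENNReal.toReal_mul,
    ENNReal.toReal_ofReal (by positivity), log_mul (by positivity) h.ne',
    log_div hΓ1.ne' hΓ2.ne']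
  ring

theorem integrableOn_rpow_neg_mul (hα : 0 < α) (hm : α < m) (hf : IsDensitySolution α m f) {s : ℝ}
    (hs : -(m - α) < s) : IntegrableOn (fun x => x ^ (-s) * f x) (Ioi 0) := by
  have hfm : Measurable f := hf.1
  refine (lintegral_ofReal_ne_top_iff_integrable (by fun_prop) ?_).mp
    (hf.negMoment_lt_top hα hm hs).ne
  exact ae_restrict_of_forall_mem measurableSet_Ioi fun x hx =>
    mul_nonneg (rpow_nonneg (le_of_lt hx) _) (hf.2.1 x hx)

theorem integral_rpow_neg_mul (hf : IsDensitySolution α m f) (s : ℝ) :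
    ∫ x in Ioi (0 : ℝ), x ^ (-s) * f x = (negMoment f s).toReal := by
  have hfm : Measurable f := hf.1
  refine integral_eq_lintegral_of_nonneg_ae ?_ (by fun_prop)
  exact ae_restrict_of_forall_mem measurableSet_Ioi fun x hx =>
    mul_nonneg (rpow_nonneg (le_of_lt hx) _) (hf.2.1 x hx)

end IsDensitySolution

/-- The logarithm of the partial product `(Γ(m)/Γ(a))^{s/a} ∏_{n=0}^N ((m+n)/(a+n))^{s/a}
Γ(1+(n+s)/a)Γ((m+n)/a)/(Γ(1+n/a)Γ((m+n+s)/a))`. -/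
def logPartialProd (a m : ℝ) (N : ℕ) (s : ℝ) : ℝ :=
  s / a * (log (Gamma m) - log (Gamma a)) + ∑ n ∈ Finset.range (N + 1),
    (s / a * (log (m + n) - log (a + n)) +
      (log (Gamma (1 + (n + s) / a)) + log (Gamma ((m + n) / a)) -
        (log (Gamma (1 + n / a)) + log (Gamma ((m + n + s) / a)))))

theorem exp_logPartialProd {a m s : ℝ} (ha : 0 < a) (hm : a ≤ m) (hs : -a < s) (N : ℕ) :
    exp (logPartialProd a m N s) =
      (Gamma m / Gamma a) ^ (s / a) * ∏ n ∈ Finset.range (N + 1), (((m + n) / (a + n)) ^ (s / a) *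
        (Gamma (1 + (n + s) / a) * Gamma ((m + n) / a) /
          (Gamma (1 + n / a) * Gamma ((m + n + s) / a)))) := by
  have hm0 : 0 < m := ha.trans_le hm
  have h1 := Gamma_pos_of_pos hm0
  have h2 := Gamma_pos_of_pos ha
  rw [logPartialProd, exp_add, exp_sum, ← log_div h1.ne' h2.ne', mul_comm (s / a),
    ← rpow_def_of_pos (by positivity)]
  congr 1
  refine Finset.prod_congr rfl fun n _ => ?_
  have hn : (0 : ℝ) ≤ n := n.cast_nonneg
  have h3 : 0 < 1 + (n + s) / a := by
    rw [← div_self ha.ne', ← add_div]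
    exact div_pos (by linarith) ha
  have h4 : 0 < (m + n + s) / a := div_pos (by linarith) ha
  have h5 := Gamma_pos_of_pos h3
  have h6 := Gamma_pos_of_pos h4
  have h7 : 0 < Gamma ((m + n) / a) := Gamma_pos_of_pos (by positivity)
  have h8 : 0 < Gamma (1 + n / a) := Gamma_pos_of_pos (by positivity)
  rw [exp_add, ← log_div (by positivity) (by positivity), mul_comm (s / a),
    ← rpow_def_of_pos (by positivity), ← log_mul h5.ne' h7.ne', ← log_mul h8.ne' h6.ne',
    ← log_div (by positivity) (by positivity), exp_log (by positivity)]

theorem logPartialProd_zero (a m : ℝ) (N : ℕ) : logPartialProd a m N 0 = 0 := by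
  simp [logPartialProd, add_comm]

theorem convexOn_logPartialProd {a m : ℝ} (ha : 0 < a) (hm : a ≤ m) (N : ℕ) :
    ConvexOn ℝ (Ioi (-a)) (logPartialProd a m N) := by
  have hterm : ∀ n : ℕ, ConvexOn ℝ (Ioi (-a)) fun s =>
      log (Gamma (1 + (n + s) / a)) - log (Gamma ((m + n + s) / a)) := by
    intro n
    have hc : 0 ≤ (m - a) / a := div_nonneg (by linarith) ha.le
    refine ⟨convex_Ioi _, fun x hx y hy p q hp hq hpq => ?_⟩
    have hpos : ∀ z ∈ Ioi (-a), 1 + (n + z) / a ∈ Ioi (0 : ℝ) := by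
      intro z hz
      have hz : -a < z := hz
      have hn : (0 : ℝ) ≤ n := n.cast_nonneg
      rw [← div_self ha.ne', ← add_div]
      exact mem_Ioi.mpr (div_pos (by linarith) ha)
    have h := (convexOn_log_Gamma_sub_log_Gamma_add hc).2 (hpos x hx) (hpos y hy) hp hq hpq
    have e : ∀ z : ℝ, 1 + (n + z) / a + (m - a) / a = (m + n + z) / a := by
      intro z
      field_simp
      ring
    have e' : p * (1 + (n + x) / a) + q * (1 + (n + y) / a) = 1 + (n + (p * x + q * y)) / a := by
      linear_combination (1 + n / a) * hpq
    simp only [smul_eq_mul, e', e] at h ⊢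
    exact h
  refine ⟨convex_Ioi _, fun x hx y hy p q hp hq hpq => ?_⟩
  simp only [logPartialProd, smul_eq_mul, mul_add, Finset.mul_sum]
  rw [add_add_add_comm, ← Finset.sum_add_distrib]
  refine add_le_add (le_of_eq (by ring)) (Finset.sum_le_sum fun n _ => ?_)
  have h := (hterm n).2 hx hy hp hq hpq
  simp only [smul_eq_mul] at h
  linear_combination h - (log (Gamma ((m + n) / a)) - log (Gamma (1 + n / a))) * hpq

theorem tendsto_logPartialProd_add_sub {a m s : ℝ} (ha : 0 < a) (hm : a ≤ m) (hs : -a < s) :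
    Tendsto (fun N => logPartialProd a m N (s + a) - logPartialProd a m N s) atTop
      (nhds (log (Gamma (m + s)) - log (Gamma (a + s)))) := by
  have hm0 : 0 < m := ha.trans_le hm
  have h := (tendsto_sum_log_ratio ha hm0 (s := s) (by linarith) (by linarith)).const_add
    (log (Gamma m) - log (Gamma a))
  convert h using 1
  · ext N
    rw [logPartialProd, logPartialProd, add_sub_add_comm, ← Finset.sum_sub_distrib]
    congr 1
    · field_simp
      ring
    refine Finset.sum_congr rfl fun n _ => ?_
    have hn : (0 : ℝ) ≤ n := n.cast_nonneg
    have p1 : 0 < a + s + n := by linarith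
    have p2 : 0 < m + s + n := by linarith
    have p3 := div_pos p1 ha
    have p4 := div_pos p2 ha
    have e1 : 1 + (n + (s + a)) / a = (a + s + n) / a + 1 := by field_simp; ring
    have e2 : 1 + (n + s) / a = (a + s + n) / a := by field_simp; ring
    have e3 : (m + n + (s + a)) / a = (m + s + n) / a + 1 := by field_simp; ring
    have e4 : (m + n + s) / a = (m + s + n) / a := by ring
    rw [e1, e2, e3, e4, Gamma_add_one p3.ne', Gamma_add_one p4.ne',
      log_mul p3.ne' (Gamma_pos_of_pos p3).ne', log_mul p4.ne' (Gamma_pos_of_pos p4).ne',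
      log_div p1.ne' ha.ne', log_div p2.ne' ha.ne', add_div, div_self ha.ne']
    ring
  · ring_nf

/-- Second Beta-product representation: for `s > −a` with `a = m − α`, the Mellin
transform of the density solution is finite and equals the limit of the partial
products `(Γ(m)/Γ(a))^{s/a} ∏_{n=0}^N ((m+n)/(a+n))^{s/a}
Γ(1+(n+s)/a)Γ((m+n)/a)/(Γ(1+n/a)Γ((m+n+s)/a))`. -/
theorem mellin_second_product_representation (α m : ℝ) (hα : 0 < α) (hm : α < m)
    (a : ℝ) (ha : a = m - α)
    (f : ℝ → ℝ) (hf : IsDensitySolution α m f) :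
    ∀ s : ℝ, -a < s →
      IntegrableOn (fun x : ℝ => x ^ (-s) * f x) (Set.Ioi (0:ℝ)) ∧
      Filter.Tendsto
        (fun N : ℕ =>
          (Real.Gamma m / Real.Gamma a) ^ (s / a) *
            ∏ n ∈ Finset.range (N + 1),
              (((m + n) / (a + n)) ^ (s / a) *
                (Real.Gamma (1 + (n + s) / a) * Real.Gamma ((m + n) / a) /
                  (Real.Gamma (1 + n / a) * Real.Gamma ((m + n + s) / a)))))
        Filter.atTop
        (nhds (∫ x in Set.Ioi (0:ℝ), x ^ (-s) * f x)) := by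
  intro s hs
  subst ha
  have ha : 0 < m - α := sub_pos.mpr hm
  refine ⟨hf.integrableOn_rpow_neg_mul hα hm hs, ?_⟩
  have hlog := tendsto_of_convexOn_of_tendsto_shift_sub ha (hf.convexOn_log_negMoment hα hm)
    (Ls := logPartialProd (m - α) m) (convexOn_logPartialProd ha (by linarith))
    (fun N => by simp [logPartialProd_zero, hf.negMoment_zero]) (fun s hs => ?_) ?_ s hs
  · rw [hf.integral_rpow_neg_mul, ← exp_log (hf.toReal_negMoment_pos hα hm hs)]
    refine ((continuous_exp.tendsto _).comp hlog).congr fun N => ?_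
    exact exp_logPartialProd ha (by linarith) hs N
  · rw [hf.log_negMoment_add_sub hα hm hs]
    exact tendsto_logPartialProd_add_sub ha (by linarith) hs
  · have hgrid : Tendsto (fun n : ℕ => n * (m - α) + (m - α)) atTop atTop :=
      tendsto_atTop_add_const_right _ _ (tendsto_natCast_atTop_atTop.atTop_mul_const ha)
    refine ((tendsto_log_Gamma_add_sub_log_Gamma_sub hα.le ha.le).comp hgrid).congr fun n => ?_
    have hn : 0 ≤ n * (m - α) := by positivity
    rw [hf.log_negMoment_add_sub hα hm (by linarith), hf.log_negMoment_add_sub hα hm (by linarith)]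
    simp only [Function.comp_apply]
    ring_nf
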